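/- arXiv:2005.13882 — 2 statements merged into one kernel-verified Lean document; each statement's English description precedes it below -/
import Mathlib

section
/- (Stein–Weiss inequality) Let n ≥ 1, let 0 < λ < n, and let a, b ∈ ℝ with a + b > 0 and λ ≤ d := a + b + λ ≤ n. Let p ∈ [1, ∞] with (n − d)p ≤ n and let q be given by 1 + 1/q = 1/p + d/n, and assume a < n/q and b < n(1 − 1/p). Then the integral operator with kernel k(x,y) = |x|^(−a) |x−y|^(−λ) |y|^(−b) is bounded from L^p(ℝⁿ) to L^q(ℝⁿ): there exists a constant C (depending only on n, a, b, λ, p) such that ‖∫_{ℝⁿ} |x|^(−a) |x−y|^(−λ) |y|^(−b) f(y) dy‖_{L^q(ℝⁿ)} ≤ C ‖f‖_{L^p(ℝⁿ)} for all f ∈ L^p(ℝⁿ). -/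
open MeasureTheory
open scoped ENNReal

/-- Hölder step of Young's inequality for kernels. -/
lemma sw_holder {X : Type*} [MeasurableSpace X] (μ : Measure X)
    (k f : X → ℝ≥0∞) (hk : Measurable k) (hf : Measurable f)
    (p r iq : ℝ) (hp : 1 ≤ p) (hr : 1 ≤ r) (hiq : 0 ≤ iq) (h : iq + 1 = 1 / p + 1 / r) :
    ∫⁻ y, k y * f y ∂μ ≤ (∫⁻ y, k y ^ r * f y ^ p ∂μ) ^ iq * (∫⁻ y, k y ^ r ∂μ) ^ (1 - 1 / p)
      * (∫⁻ y, f y ^ p ∂μ) ^ (1 - 1 / r) := by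
  have hp0 : 0 < p := by linarith
  have hr0 : 0 < r := by linarith
  have h1 : 0 ≤ 1 - 1 / p := by
    rw [sub_nonneg, div_le_one hp0]; exact hp
  have h2 : 0 ≤ 1 - 1 / r := by
    rw [sub_nonneg, div_le_one hr0]; exact hr
  have key := ENNReal.lintegral_prod_norm_pow_le (μ := μ) (Finset.univ : Finset (Fin 3))
    (f := ![fun y => k y ^ r * f y ^ p, fun y => k y ^ r, fun y => f y ^ p])
    (p := ![iq, 1 - 1 / p, 1 - 1 / r]) ?_ ?_ ?_
  · simp only [Fin.prod_univ_three, Matrix.cons_val_zero, Matrix.cons_val_one,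
      Matrix.cons_val] at key
    refine le_trans (le_of_eq ?_) key
    congr 1
    ext y
    rw [ENNReal.mul_rpow_of_nonneg _ _ hiq, ← ENNReal.rpow_mul, ← ENNReal.rpow_mul,
      ← ENNReal.rpow_mul, ← ENNReal.rpow_mul]
    have e1 : k y = k y ^ (r * iq) * k y ^ (r * (1 - 1 / p)) := by
      rw [← ENNReal.rpow_add_of_nonneg _ _ (by positivity) (by positivity), ← mul_add]
      rw [show iq + (1 - 1 / p) = 1 / r by linarith, mul_one_div_cancel hr0.ne', ENNReal.rpow_one]
    have e2 : f y = f y ^ (p * iq) * f y ^ (p * (1 - 1 / r)) := by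
      rw [← ENNReal.rpow_add_of_nonneg _ _ (by positivity) (by positivity), ← mul_add]
      rw [show iq + (1 - 1 / r) = 1 / p by linarith, mul_one_div_cancel hp0.ne', ENNReal.rpow_one]
    conv_lhs => rw [e1, e2]
    ring
  · intro i _
    fin_cases i
    · exact ((hk.pow_const r).mul (hf.pow_const p)).aemeasurable
    · exact (hk.pow_const r).aemeasurable
    · exact (hf.pow_const p).aemeasurable
  · simp [Fin.sum_univ_three]; simp at h; linarith
  · intro i _
    fin_cases i
    · exact hiq
    · exact h1
    · exact h2

/-- Young's inequality for kernels, finite target exponent. -/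
lemma sw_young {X : Type*} [MeasurableSpace X] (μ : Measure X) [SFinite μ]
    (k : X → X → ℝ≥0∞) (f : X → ℝ≥0∞) (hk : Measurable (Function.uncurry k)) (hf : Measurable f)
    (A : ℝ≥0∞) (p r q : ℝ) (hp : 1 ≤ p) (hr : 1 ≤ r) (hq : 0 < q) (h : 1 / q + 1 = 1 / p + 1 / r)
    (h1 : ∀ x, ∫⁻ y, k x y ^ r ∂μ ≤ A) (h2 : ∀ y, ∫⁻ x, k x y ^ r ∂μ ≤ A) :
    (∫⁻ x, (∫⁻ y, k x y * f y ∂μ) ^ q ∂μ) ^ (1 / q) ≤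
      A ^ (1 / r) * (∫⁻ y, f y ^ p ∂μ) ^ (1 / p) := by
  have hp0 : 0 < p := by linarith
  have hr0 : 0 < r := by linarith
  have hp1 : 0 ≤ 1 - 1 / p := by
    rw [sub_nonneg, div_le_one hp0]; exact hp
  have hr1 : 0 ≤ 1 - 1 / r := by
    rw [sub_nonneg, div_le_one hr0]; exact hr
  set N := ∫⁻ y, f y ^ p ∂μ with hN
  have hkm : Measurable (fun z : X × X => k z.1 z.2 ^ r * f z.2 ^ p) :=
    (hk.pow_const r).mul ((hf.comp measurable_snd).pow_const p)
  have step : ∀ x, (∫⁻ y, k x y * f y ∂μ) ^ q ≤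
      (∫⁻ y, k x y ^ r * f y ^ p ∂μ) * (A ^ (1 - 1 / p) * N ^ (1 - 1 / r)) ^ q := by
    intro x
    have := sw_holder μ (k x) f (hk.comp measurable_prodMk_left) hf p r (1 / q) hp hr
      (by positivity) h
    calc (∫⁻ y, k x y * f y ∂μ) ^ q ≤ ((∫⁻ y, k x y ^ r * f y ^ p ∂μ) ^ (1 / q)
          * (A ^ (1 - 1 / p) * N ^ (1 - 1 / r))) ^ q := by
          refine ENNReal.rpow_le_rpow (this.trans ?_) hq.le
          rw [mul_assoc]
          gcongr
          exact h1 x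
      _ = _ := by
          rw [ENNReal.mul_rpow_of_nonneg _ _ hq.le, ← ENNReal.rpow_mul,
            one_div_mul_cancel hq.ne', ENNReal.rpow_one]
  have tot : ∫⁻ x, (∫⁻ y, k x y * f y ∂μ) ^ q ∂μ ≤
      (A * N) * (A ^ (1 - 1 / p) * N ^ (1 - 1 / r)) ^ q := by
    calc _ ≤ ∫⁻ x, (∫⁻ y, k x y ^ r * f y ^ p ∂μ) *
            (A ^ (1 - 1 / p) * N ^ (1 - 1 / r)) ^ q ∂μ := lintegral_mono step
      _ = (∫⁻ x, ∫⁻ y, k x y ^ r * f y ^ p ∂μ ∂μ) *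
            (A ^ (1 - 1 / p) * N ^ (1 - 1 / r)) ^ q :=
          lintegral_mul_const _ hkm.lintegral_prod_right'
      _ ≤ _ := by
          gcongr
          rw [lintegral_lintegral_swap hkm.aemeasurable]
          calc _ = ∫⁻ y, (∫⁻ x, k x y ^ r ∂μ) * f y ^ p ∂μ := by
                congr 1; ext y
                exact lintegral_mul_const _ ((hk.comp measurable_prodMk_right).pow_const r)
            _ ≤ ∫⁻ y, A * f y ^ p ∂μ := by
                apply lintegral_mono; intro y; dsimp only; gcongr; exact h2 y
            _ = A * N := lintegral_const_mul _ (hf.pow_const p)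
  calc _ ≤ ((A * N) * (A ^ (1 - 1 / p) * N ^ (1 - 1 / r)) ^ q) ^ (1 / q) :=
        ENNReal.rpow_le_rpow tot (by positivity)
    _ = (A ^ (1 / q) * A ^ (1 - 1 / p)) * (N ^ (1 / q) * N ^ (1 - 1 / r)) := by
        rw [ENNReal.mul_rpow_of_nonneg _ _ (by positivity : 0 ≤ 1 / q), ← ENNReal.rpow_mul,
          mul_one_div_cancel hq.ne', ENNReal.rpow_one,
          ENNReal.mul_rpow_of_nonneg _ _ (by positivity : 0 ≤ 1 / q)]
        ring
    _ = _ := by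
        rw [← ENNReal.rpow_add_of_nonneg _ _ (by positivity) hp1,
          ← ENNReal.rpow_add_of_nonneg _ _ (by positivity) hr1]
        congr 2
        · linarith
        · linarith

/-- local integrability of powers -/
lemma sw_ball {n : ℕ} (hn : 1 ≤ n) (γ R : ℝ) (hγ : -n < γ) (hR : 0 < R) :
    ∫⁻ y in Metric.ball (0 : EuclideanSpace ℝ (Fin n)) R, ENNReal.ofReal (‖y‖ ^ γ) < ∞ := by
  have : Nonempty (Fin n) := ⟨⟨0, hn⟩⟩
  have h : IntegrableOn (fun x : EuclideanSpace ℝ (Fin n) => ‖x‖ ^ γ) (Metric.ball 0 R) := by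
    rw [integrableOn_fun_norm_addHaar volume (f := fun t : ℝ => t ^ γ)]
    have : IntegrableOn (fun t : ℝ => t ^ ((n : ℝ) - 1 + γ)) (Set.Ioo 0 R) := by
      rw [intervalIntegral.integrableOn_Ioo_rpow_iff hR]; linarith
    refine this.congr_fun ?_ measurableSet_Ioo
    intro t ht
    have ht0 : 0 < t := ht.1
    simp only [finrank_euclideanSpace_fin, smul_eq_mul]
    rw [Real.rpow_add ht0, ← Nat.cast_one, ← Nat.cast_sub hn, Real.rpow_natCast]
  have := h.lintegral_lt_top
  exact this

lemma sw_scale {n : ℕ} (g : EuclideanSpace ℝ (Fin n) → ℝ≥0∞) (t : ℝ) (ht : 0 < t) :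
    ∫⁻ y, g y = ENNReal.ofReal (t ^ (n : ℝ)) * ∫⁻ z, g (t • z) := by
  have h1 : ∫⁻ z, g (t • z) = ∫⁻ y, g y ∂(Measure.map (t • ·) volume) :=
    (lintegral_map_equiv g (Homeomorph.smulOfNeZero t ht.ne').toMeasurableEquiv).symm
  rw [h1, Measure.map_addHaar_smul _ ht.ne', lintegral_smul_measure, smul_eq_mul, ← mul_assoc,
    ← ENNReal.ofReal_mul (by positivity), finrank_euclideanSpace_fin, Real.rpow_natCast,
    abs_of_pos (by positivity), mul_inv_cancel₀ (by positivity), ENNReal.ofReal_one, one_mul]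

/-- The basic integral is bounded uniformly over the unit sphere. -/
lemma sw_unit {n : ℕ} (hn : 1 ≤ n) (α β s : ℝ) (hα : 0 < α) (hβ : 0 < β) (hs : α + β = s)
    (hsn : s < n) : ∃ A : ℝ≥0∞, A < ∞ ∧ ∀ u : EuclideanSpace ℝ (Fin n), ‖u‖ = 1 →
      ∫⁻ y, ENNReal.ofReal (‖y‖ ^ (β - n) * ‖u - y‖ ^ (-s)) ≤ A := by
  let B : Set (EuclideanSpace ℝ (Fin n)) := Metric.ball 0 3
  let H1 : EuclideanSpace ℝ (Fin n) → ℝ≥0∞ :=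
    B.indicator (fun y => ENNReal.ofReal (‖y‖ ^ (β - n)))
  let H2 : EuclideanSpace ℝ (Fin n) → ℝ≥0∞ := B.indicator (fun y => ENNReal.ofReal (‖y‖ ^ (-s)))
  let H3 : EuclideanSpace ℝ (Fin n) → ℝ≥0∞ :=
    fun y => ENNReal.ofReal ((1 + ‖y‖) ^ (-(n + α)))
  let c1 : ℝ := (1 / 2) ^ (-s)
  let c2 : ℝ := (1 / 2) ^ (β - n)
  let c3 : ℝ := (1 / 3) ^ (-(n + α))
  have hB : MeasurableSet B := measurableSet_ball
  have m1 : Measurable H1 := Measurable.indicator (by fun_prop) hB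
  have m2 : Measurable H2 := Measurable.indicator (by fun_prop) hB
  have m3 : Measurable H3 := by fun_prop
  have i1 : ∫⁻ y, H1 y < ∞ := by
    rw [lintegral_indicator hB]
    exact sw_ball hn _ _ (by linarith) (by norm_num)
  have i2 : ∫⁻ y, H2 y < ∞ := by
    rw [lintegral_indicator hB]
    exact sw_ball hn _ _ (by linarith) (by norm_num)
  have i3 : ∫⁻ y, H3 y < ∞ := by
    apply finite_integral_one_add_norm
    rw [finrank_euclideanSpace_fin]; linarith
  refine ⟨ENNReal.ofReal c1 * (∫⁻ y, H1 y) + ENNReal.ofReal c2 * (∫⁻ y, H2 y)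
    + ENNReal.ofReal c3 * (∫⁻ y, H3 y), ?_, ?_⟩
  · have := i1.ne
    have := i2.ne
    have := i3.ne
    finiteness
  intro u hu
  have hpt : ∀ y, ENNReal.ofReal (‖y‖ ^ (β - n) * ‖u - y‖ ^ (-s)) ≤
      ENNReal.ofReal c1 * H1 y + ENNReal.ofReal c2 * H2 (u - y) + ENNReal.ofReal c3 * H3 y := by
    intro y
    have t1 : ‖u‖ ≤ ‖u - y‖ + ‖y‖ := by simpa using norm_add_le (u - y) y
    have t2 : ‖y‖ ≤ ‖u - y‖ + ‖u‖ := by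
      have := norm_sub_le u (u - y)
      simp at this
      linarith
    have t3 : ‖u - y‖ ≤ ‖u‖ + ‖y‖ := norm_sub_le u y
    rw [hu] at t1 t2 t3
    rcases lt_or_ge ‖y‖ (1 / 2) with h | h
    · have hm : y ∈ B := by simp [B]; linarith
      refine le_trans ?_ (le_trans le_self_add le_self_add)
      simp only [H1, Set.indicator_of_mem hm]
      rw [← ENNReal.ofReal_mul (by positivity), mul_comm]
      apply ENNReal.ofReal_le_ofReal
      gcongr
      exact Real.rpow_le_rpow_of_nonpos (by norm_num) (by linarith) (by linarith)
    rcases lt_or_ge ‖y‖ 2 with h' | h'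
    · have hm : u - y ∈ B := by simp only [B, mem_ball_zero_iff]; linarith
      refine le_trans ?_ (le_trans le_add_self le_self_add)
      simp only [H2, Set.indicator_of_mem hm]
      rw [← ENNReal.ofReal_mul (by positivity)]
      apply ENNReal.ofReal_le_ofReal
      gcongr
      exact Real.rpow_le_rpow_of_nonpos (by norm_num) (by linarith) (by linarith)
    · refine le_trans ?_ le_add_self
      simp only [H3]
      rw [← ENNReal.ofReal_mul (by positivity)]
      apply ENNReal.ofReal_le_ofReal
      have hw : 0 < 1 / 3 * (1 + ‖y‖) := by positivity
      calc ‖y‖ ^ (β - n) * ‖u - y‖ ^ (-s) ≤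
            (1 / 3 * (1 + ‖y‖)) ^ (β - n) * (1 / 3 * (1 + ‖y‖)) ^ (-s) := by
            gcongr ?_ * ?_
            · exact Real.rpow_le_rpow_of_nonpos hw (by linarith) (by linarith)
            · exact Real.rpow_le_rpow_of_nonpos hw (by linarith) (by linarith)
        _ = c3 * (1 + ‖y‖) ^ (-(n + α)) := by
            rw [← Real.rpow_add hw, ← Real.mul_rpow (by norm_num) (by positivity)]
            congr 1; linarith
  calc _ ≤ _ := lintegral_mono hpt
    _ = _ := by
      have m2' : Measurable (fun y => H2 (u - y)) := m2.comp (by fun_prop)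
      rw [lintegral_add_right _ (m3.const_mul _), lintegral_add_right _ (m2'.const_mul _),
        lintegral_const_mul _ m1, lintegral_const_mul _ m2', lintegral_const_mul _ m3,
        lintegral_sub_left_eq_self H2 u]

lemma sw_int {n : ℕ} (hn : 1 ≤ n) (α β s : ℝ) (hα : 0 < α) (hβ : 0 < β) (hs : α + β = s)
    (hsn : s < n) : ∃ A : ℝ≥0∞, A < ∞ ∧ ∀ x : EuclideanSpace ℝ (Fin n),
      ∫⁻ y, ENNReal.ofReal (‖x‖ ^ α * ‖y‖ ^ (β - n) * ‖x - y‖ ^ (-s)) ≤ A := by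
  obtain ⟨A, hA, h⟩ := sw_unit hn α β s hα hβ hs hsn
  refine ⟨A, hA, fun x => ?_⟩
  rcases eq_or_ne x 0 with rfl | hx
  · simp [Real.zero_rpow hα.ne']
  have ht : 0 < ‖x‖ := norm_pos_iff.mpr hx
  set t := ‖x‖ with htd
  have hu : ‖t⁻¹ • x‖ = 1 := by
    rw [norm_smul, norm_inv, htd, norm_norm, inv_mul_cancel₀ ht.ne']
  rw [sw_scale _ t ht, ← lintegral_const_mul' _ _ ENNReal.ofReal_ne_top]
  refine le_trans (le_of_eq ?_) (h _ hu)
  congr 1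
  ext z
  rw [← ENNReal.ofReal_mul (by positivity)]
  congr 1
  have e : x - t • z = t • (t⁻¹ • x - z) := by
    rw [smul_sub, smul_smul, mul_inv_cancel₀ ht.ne', one_smul]
  rw [e, norm_smul, norm_smul, Real.norm_of_nonneg ht.le, Real.mul_rpow ht.le (norm_nonneg _),
    Real.mul_rpow ht.le (norm_nonneg _)]
  have : t ^ (n : ℝ) * t ^ α * t ^ (β - n) * t ^ (-s) = 1 := by
    rw [← Real.rpow_add ht, ← Real.rpow_add ht, ← Real.rpow_add ht]
    rw [show (n : ℝ) + α + (β - n) + -s = 0 by linarith, Real.rpow_zero]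
  linear_combination (‖z‖ ^ (β - n) * ‖t⁻¹ • x - z‖ ^ (-s)) * this

/-- The measure `|x|^(-n) dx`. -/
noncomputable def swMeas (n : ℕ) : Measure (EuclideanSpace ℝ (Fin n)) :=
  volume.withDensity (fun x => ENNReal.ofReal (‖x‖ ^ (-(n : ℝ))))

/-- The degree-zero kernel. -/
noncomputable def swK (n : ℕ) (α β s : ℝ) (x y : EuclideanSpace ℝ (Fin n)) : ℝ≥0∞ :=
  ENNReal.ofReal (‖x‖ ^ α * ‖y‖ ^ β * ‖x - y‖ ^ (-s))

instance (n : ℕ) : SFinite (swMeas n) := by unfold swMeas; infer_instance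

lemma swMeas_lintegral {n : ℕ} (g : EuclideanSpace ℝ (Fin n) → ℝ≥0∞) (hg : Measurable g) :
    ∫⁻ x, g x ∂(swMeas n) = ∫⁻ x, ENNReal.ofReal (‖x‖ ^ (-(n : ℝ))) * g x := by
  unfold swMeas
  rw [lintegral_withDensity_eq_lintegral_mul _ (by fun_prop) hg]
  rfl

lemma swK_meas (n : ℕ) (α β s : ℝ) : Measurable (Function.uncurry (swK n α β s)) := by
  unfold swK Function.uncurry
  fun_prop

lemma swK_symm (n : ℕ) (α β s : ℝ) (x y : EuclideanSpace ℝ (Fin n)) :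
    swK n α β s x y = swK n β α s y x := by
  unfold swK
  rw [norm_sub_rev]
  congr 1
  ring

lemma sw_ae_ne {n : ℕ} (hn : 1 ≤ n) : ∀ᵐ y : EuclideanSpace ℝ (Fin n), 0 < ‖y‖ := by
  have : Nonempty (Fin n) := ⟨⟨0, hn⟩⟩
  filter_upwards [Measure.ae_ne volume (0 : EuclideanSpace ℝ (Fin n))] with y hy
  exact norm_pos_iff.mpr hy

lemma swK_rpow (n : ℕ) (α β s r : ℝ) (hr : 0 ≤ r) (x y : EuclideanSpace ℝ (Fin n)) :
    swK n α β s x y ^ r = swK n (α * r) (β * r) (s * r) x y := by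
  unfold swK
  rw [ENNReal.ofReal_rpow_of_nonneg (by positivity) hr, Real.mul_rpow (by positivity) (by positivity),
    Real.mul_rpow (by positivity) (by positivity), ← Real.rpow_mul (norm_nonneg _),
    ← Real.rpow_mul (norm_nonneg _), ← Real.rpow_mul (norm_nonneg _), neg_mul]

lemma swK_int {n : ℕ} (hn : 1 ≤ n) (α β s r : ℝ) (hr : 0 < r) (hα : 0 < α) (hβ : 0 < β)
    (hs : α + β = s) (hsn : s * r < n) : ∃ A : ℝ≥0∞, A < ∞ ∧
      ∀ x : EuclideanSpace ℝ (Fin n), ∫⁻ y, swK n α β s x y ^ r ∂(swMeas n) ≤ A := by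
  obtain ⟨A, hA, h⟩ := sw_int hn (α * r) (β * r) (s * r) (by positivity) (by positivity)
    (by rw [← hs]; ring) hsn
  refine ⟨A, hA, fun x => le_trans (le_of_eq ?_) (h x)⟩
  have hm : Measurable (fun y => swK n α β s x y ^ r) :=
    ((swK_meas n α β s).comp measurable_prodMk_left).pow_const r
  rw [swMeas_lintegral _ hm]
  apply lintegral_congr_ae
  filter_upwards [sw_ae_ne hn] with y hy
  rw [swK_rpow _ _ _ _ _ hr.le, swK, ← ENNReal.ofReal_mul (by positivity),
    sub_eq_add_neg (β * r), Real.rpow_add hy]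
  congr 1
  ring


/-- Pointwise reduction to the degree-zero kernel. -/
lemma sw_pointwise {n : ℕ} (hn : 1 ≤ n) (a b lam ip iq : ℝ)
    (f : EuclideanSpace ℝ (Fin n) → ℝ) (g : EuclideanSpace ℝ (Fin n) → ℝ≥0∞) (hg : Measurable g)
    (hfg : (fun y => ‖f y‖ₑ) =ᵐ[volume] g) (x : EuclideanSpace ℝ (Fin n)) (hx : 0 < ‖x‖) :
    ‖∫ y, ‖x‖ ^ (-a) * ‖x - y‖ ^ (-lam) * ‖y‖ ^ (-b) * f y‖ₑ ≤
      ENNReal.ofReal (‖x‖ ^ (-(n * iq))) *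
      ∫⁻ y, swK n (n * iq - a) (n * (1 - ip) - b) lam x y *
        (ENNReal.ofReal (‖y‖ ^ (n * ip)) * g y) ∂(swMeas n) := by
  have hm : Measurable (fun y => swK n (n * iq - a) (n * (1 - ip) - b) lam x y *
        (ENNReal.ofReal (‖y‖ ^ (n * ip)) * g y)) :=
    ((swK_meas n _ _ _).comp measurable_prodMk_left).mul
      (Measurable.mul (by fun_prop) hg)
  refine (enorm_integral_le_lintegral_enorm _).trans (le_of_eq ?_)
  rw [swMeas_lintegral _ hm, ← lintegral_const_mul' _ _ ENNReal.ofReal_ne_top]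
  apply lintegral_congr_ae
  filter_upwards [sw_ae_ne hn, hfg] with y hy hfy
  rw [enorm_mul, hfy, Real.enorm_of_nonneg (by positivity), swK]
  simp only [← mul_assoc]
  congr 1
  rw [← ENNReal.ofReal_mul (by positivity), ← ENNReal.ofReal_mul (by positivity),
    ← ENNReal.ofReal_mul (by positivity)]
  congr 1
  have e1 : ‖x‖ ^ (-a) = ‖x‖ ^ (-(n * iq)) * ‖x‖ ^ (n * iq - a) := by
    rw [← Real.rpow_add hx]; congr 1; ring
  have e2 : ‖y‖ ^ (-b) = ‖y‖ ^ (-(n : ℝ)) * ‖y‖ ^ (n * (1 - ip) - b) * ‖y‖ ^ (n * ip) := by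
    rw [← Real.rpow_add hy, ← Real.rpow_add hy]; congr 1; ring
  rw [e1, e2]
  ring

/-- **Stein–Weiss inequality.** Let `0 < λ < n`, `a + b > 0`, `λ ≤ d := a + b + λ ≤ n`,
`p ∈ [1,∞]` with `(n-d)p ≤ n`, `1 + 1/q = 1/p + d/n`, `a < n/q` and `b < n(1 - 1/p)`.
Then the integral operator with kernel `|x|^(-a) |x-y|^(-λ) |y|^(-b)` is bounded from
`Lᵖ(ℝⁿ)` to `L^q(ℝⁿ)`. -/
theorem stein_weiss_inequality
    {n : ℕ} (hn : 1 ≤ n) (a b lam : ℝ)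
    (hlam0 : 0 < lam) (hlamn : lam < n)
    (hab : 0 < a + b) (hd : a + b + lam ≤ n)
    (p q : ℝ≥0∞) (hp : 1 ≤ p)
    (hpd : ENNReal.ofReal ((n : ℝ) - (a + b + lam)) * p ≤ (n : ℝ≥0∞))
    (hq : 1 + 1 / q = 1 / p + ENNReal.ofReal ((a + b + lam) / n))
    (ha : a < (n : ℝ) / q.toReal)
    (hb : b < (n : ℝ) * (1 - (1 / p).toReal)) :
    ∃ C > (0 : ℝ), ∀ f : EuclideanSpace ℝ (Fin n) → ℝ, MemLp f p volume →
      eLpNorm (fun x => ∫ y, ‖x‖ ^ (-a) * ‖x - y‖ ^ (-lam) * ‖y‖ ^ (-b) * f y) q volume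
        ≤ ENNReal.ofReal C * eLpNorm f p volume := by


  have hn0 : (0 : ℝ) < n := by exact_mod_cast hn
  obtain ⟨d, hdd⟩ : ∃ d, d = a + b + lam := ⟨_, rfl⟩
  rw [← hdd] at hd hpd hq
  have hd0 : 0 < d := by linarith
  obtain ⟨ip, hip⟩ : ∃ ip, ip = (1 / p).toReal := ⟨_, rfl⟩
  obtain ⟨iq, hiq⟩ : ∃ iq, iq = (1 / q).toReal := ⟨_, rfl⟩
  have hp0 : p ≠ 0 := fun h => by simp [h] at hp
  have hipf : 1 / p ≠ ∞ := by simp [hp0]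
  have hiqf : 1 / q ≠ ∞ := by
    intro h
    rw [h, add_top] at hq
    exact ENNReal.add_ne_top.2 ⟨hipf, ENNReal.ofReal_ne_top⟩ hq.symm
  have hq0 : q ≠ 0 := fun h => by simp [h] at hiqf
  have hrel : 1 + iq = ip + d / n := by
    have := congrArg ENNReal.toReal hq
    rw [ENNReal.toReal_add (by simp) hiqf, ENNReal.toReal_add hipf (by simp),
      ENNReal.toReal_ofReal (by positivity), ENNReal.toReal_one] at this
    rw [hiq, hip]; exact this
  have hiq0 : 0 ≤ iq := by rw [hiq]; positivity
  have ha' : a < n * iq := by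
    rw [hiq, one_div, ENNReal.toReal_inv, ← div_eq_mul_inv]; exact ha
  rw [← hip] at hb
  have hsum : (n * iq - a) + (n * (1 - ip) - b) = lam := by
    have : (n : ℝ) * (1 + iq) = n * ip + d := by
      rw [hrel, mul_add, mul_div_cancel₀ _ hn0.ne']
    linarith
  obtain ⟨r, hrd⟩ : ∃ r : ℝ, r = n / d := ⟨_, rfl⟩
  have hr1 : 1 ≤ r := by rw [hrd, one_le_div hd0]; exact hd
  have hr0 : 0 < r := by linarith
  have hrinv : 1 / r = d / n := by rw [hrd, one_div_div]
  have hlr : lam * r < n := by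
    rw [hrd, ← mul_div_assoc, div_lt_iff₀ hd0, mul_comm]
    gcongr; linarith
  obtain ⟨A₁, hA₁, h₁⟩ := swK_int hn (n * iq - a) (n * (1 - ip) - b) lam r hr0 (by linarith)
    (by linarith) hsum hlr
  obtain ⟨A₂, hA₂, h₂⟩ := swK_int hn (n * (1 - ip) - b) (n * iq - a) lam r hr0 (by linarith)
    (by linarith) (by linarith) hlr
  obtain ⟨A, hA⟩ : ∃ A, A = A₁ + A₂ := ⟨_, rfl⟩
  have hAf : A ^ (1 / r) ≠ ∞ := by
    apply ENNReal.rpow_ne_top_of_nonneg (by positivity)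
    rw [hA]; exact (ENNReal.add_lt_top.2 ⟨hA₁, hA₂⟩).ne
  refine ⟨(A ^ (1 / r)).toReal + 1, by positivity, fun f hf => ?_⟩
  have hC : A ^ (1 / r) ≤ ENNReal.ofReal ((A ^ (1 / r)).toReal + 1) := by
    conv_lhs => rw [← ENNReal.ofReal_toReal hAf]
    exact ENNReal.ofReal_le_ofReal (by linarith)
  refine le_trans ?_ (mul_le_mul_left hC _)
  have hfm : AEMeasurable (fun y => ‖f y‖ₑ) volume := hf.1.enorm
  obtain ⟨g, hg, hfg⟩ := hfm
  obtain ⟨k, hk⟩ : ∃ k, k = swK n (n * iq - a) (n * (1 - ip) - b) lam := ⟨_, rfl⟩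
  obtain ⟨G, hG⟩ : ∃ G : EuclideanSpace ℝ (Fin n) → ℝ≥0∞,
    G = fun y => ENNReal.ofReal (‖y‖ ^ (n * ip)) * g y := ⟨_, rfl⟩
  have hkm : Measurable (Function.uncurry k) := hk ▸ swK_meas _ _ _ _
  have hkx : ∀ x, Measurable (k x) := fun x => hkm.comp measurable_prodMk_left
  have hGm : Measurable G := by
    rw [hG]
    exact Measurable.mul (by fun_prop) hg
  have hpt : ∀ᵐ x : EuclideanSpace ℝ (Fin n),
      ‖∫ y, ‖x‖ ^ (-a) * ‖x - y‖ ^ (-lam) * ‖y‖ ^ (-b) * f y‖ₑ ≤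
      ENNReal.ofReal (‖x‖ ^ (-(n * iq))) * ∫⁻ y, k x y * G y ∂(swMeas n) := by
    filter_upwards [sw_ae_ne hn] with x hx
    rw [hk, hG]
    exact sw_pointwise hn a b lam ip iq f g hg hfg x hx
  have hk1 : ∀ x, ∫⁻ y, k x y ^ r ∂(swMeas n) ≤ A := fun x => by
    rw [hk, hA]; exact (h₁ x).trans le_self_add
  have hk2 : ∀ y, ∫⁻ x, k x y ^ r ∂(swMeas n) ≤ A := fun y => by
    rw [hk, hA]
    simp_rw [swK_symm n (n * iq - a) _ lam _ y]
    exact (h₂ y).trans le_add_self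
  by_cases hpt' : p = ∞
  · have hip0 : ip = 0 := by rw [hip, hpt']; simp
    have hdn : d / n ≤ 1 := by rw [div_le_one hn0]; exact hd
    have hiq0' : iq = 0 := by linarith
    have hqt : q = ∞ := by
      rw [hiq, ENNReal.toReal_eq_zero_iff] at hiq0'
      simpa [hiqf, hq0] using hiq0'
    have hr : r = 1 := by
      have : 1 / r = 1 := by linarith
      rw [div_eq_iff hr0.ne'] at this; linarith
    subst hpt' hqt
    rw [eLpNorm_exponent_top, eLpNorm_exponent_top]
    apply eLpNormEssSup_le_of_ae_enorm_bound
    filter_upwards [hpt] with x hx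
    refine hx.trans ?_
    rw [hiq0', hr]
    have hGb : ∀ᵐ y ∂(swMeas n), G y ≤ eLpNormEssSup f volume := by
      apply (withDensity_absolutelyContinuous _ _ : swMeas n ≪ volume)
      filter_upwards [hfg, enorm_ae_le_eLpNormEssSup f volume] with y h1 h2
      rw [hG, hip0]
      simpa [← h1] using h2
    simp only [mul_zero, neg_zero, Real.rpow_zero, ENNReal.ofReal_one, one_mul, div_one,
      ENNReal.rpow_one]
    calc _ ≤ ∫⁻ y, k x y * eLpNormEssSup f volume ∂(swMeas n) := by
          apply lintegral_mono_ae
          filter_upwards [hGb] with y hy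
          gcongr
      _ = (∫⁻ y, k x y ∂(swMeas n)) * eLpNormEssSup f volume :=
          lintegral_mul_const _ (hkx x)
      _ ≤ _ := by
          gcongr
          simpa [hr] using hk1 x
  · obtain ⟨P, hP⟩ : ∃ P, P = p.toReal := ⟨_, rfl⟩
    have hP1 : 1 ≤ P := by
      rw [hP]; simpa using ENNReal.toReal_mono hpt' hp
    have hP0 : 0 < P := by linarith
    have hipP : ip = 1 / P := by rw [hip, hP]; simp
    have hN : (∫⁻ y, G y ^ P ∂(swMeas n)) ^ (1 / P) = eLpNorm f p volume := by
      rw [eLpNorm_eq_lintegral_rpow_enorm_toReal hp0 hpt', ← hP,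
        swMeas_lintegral _ (hGm.pow_const P)]
      congr 1
      apply lintegral_congr_ae
      filter_upwards [sw_ae_ne hn, hfg] with y hy h1
      rw [h1, hG]
      dsimp only
      rw [ENNReal.mul_rpow_of_nonneg _ _ hP0.le,
        ENNReal.ofReal_rpow_of_nonneg (by positivity) hP0.le, ← Real.rpow_mul hy.le, hipP,
        mul_assoc, one_div_mul_cancel hP0.ne', mul_one, ← mul_assoc,
        ← ENNReal.ofReal_mul (by positivity), ← Real.rpow_add hy]
      simp
    rw [← hN]
    by_cases hqt : q = ∞
    · have hiq0' : iq = 0 := by rw [hiq, hqt]; simp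
      subst hqt
      rw [eLpNorm_exponent_top]
      apply eLpNormEssSup_le_of_ae_enorm_bound
      filter_upwards [hpt] with x hx
      refine hx.trans ?_
      have hh := sw_holder (swMeas n) (k x) G (hkx x) hGm P r 0 hP1 hr1 le_rfl (by linarith)
      rw [hiq0']
      simp only [mul_zero, neg_zero, Real.rpow_zero, ENNReal.ofReal_one, one_mul]
      refine hh.trans ?_
      rw [ENNReal.rpow_zero, one_mul, show 1 - 1 / P = 1 / r by linarith,
        show 1 - 1 / r = 1 / P by linarith]
      gcongr
      exact hk1 x
    · obtain ⟨Q, hQ⟩ : ∃ Q, Q = q.toReal := ⟨_, rfl⟩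
      have hQ0 : 0 < Q := by rw [hQ]; exact ENNReal.toReal_pos hq0 hqt
      have hiqQ : iq = 1 / Q := by rw [hiq, hQ]; simp
      rw [eLpNorm_eq_lintegral_rpow_enorm_toReal hq0 hqt, ← hQ]
      refine le_trans ?_ (sw_young (swMeas n) k G hkm hGm A P r Q hP1 hr1 hQ0 (by linarith)
        hk1 hk2)
      have hFm : Measurable (fun x => (∫⁻ y, k x y * G y ∂(swMeas n)) ^ Q) := by
        have : Measurable (fun z : EuclideanSpace ℝ (Fin n) × EuclideanSpace ℝ (Fin n) =>
            k z.1 z.2 * G z.2) := hkm.mul (hGm.comp measurable_snd)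
        exact this.lintegral_prod_right'.pow_const Q
      apply ENNReal.rpow_le_rpow _ (by positivity)
      rw [swMeas_lintegral _ hFm]
      apply lintegral_mono_ae
      filter_upwards [hpt, sw_ae_ne hn] with x hx hx0
      refine (ENNReal.rpow_le_rpow hx hQ0.le).trans (le_of_eq ?_)
      rw [ENNReal.mul_rpow_of_nonneg _ _ hQ0.le,
        ENNReal.ofReal_rpow_of_nonneg (by positivity) hQ0.le, ← Real.rpow_mul hx0.le, hiqQ,
        neg_mul, mul_assoc, one_div_mul_cancel hQ0.ne', mul_one]
end

section
/- Let n ≥ 1 and let g ∈ L^p(ℝⁿ; ℝⁿ) for some p ∈ [1, ∞) with (n − 1)p < n. If h ∈ L¹(ℝⁿ) is the distributional divergence of g, i.e. ∫_{ℝⁿ} h(x) v(x) dx = − ∫_{ℝⁿ} g(x) · ∇v(x) dx for every smooth compactly supported function v : ℝⁿ → ℝ, then ∫_{ℝⁿ} h(x) dx = 0. More precisely, for any smooth compactly supported χ : ℝⁿ → [0,1] equal to 1 on the unit ball and to 0 outside the ball of radius 2, one has −(1/k) ∫_{ℝⁿ} g(x) · ∇χ(x/k) dx → 0 as k → ∞.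 -/
open MeasureTheory
open scoped ENNReal RealInnerProductSpace

lemma grad_bound {n : ℕ} (χ : EuclideanSpace ℝ (Fin n) → ℝ) (hχ : ContDiff ℝ (⊤ : ℕ∞) χ)
    (hc : HasCompactSupport χ) : ∃ M : ℝ, 0 ≤ M ∧ ∀ x, ‖gradient χ x‖ ≤ M := by
  have h1 : Continuous (fderiv ℝ χ) := hχ.continuous_fderiv (by simp)
  obtain ⟨M, hM⟩ := h1.bounded_above_of_compact_support (hc.fderiv (𝕜 := ℝ))
  refine ⟨M, (norm_nonneg _).trans (hM 0), fun x => ?_⟩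
  simpa [gradient] using hM x

lemma grad_zero {n : ℕ} (χ : EuclideanSpace ℝ (Fin n) → ℝ)
    (h0 : ∀ x, 2 ≤ ‖x‖ → χ x = 0) (x : EuclideanSpace ℝ (Fin n)) (hx : 2 < ‖x‖) :
    gradient χ x = 0 := by
  have h1 : χ =ᶠ[nhds x] fun _ => (0 : ℝ) := by
    have : ∀ᶠ y in nhds x, 2 < ‖y‖ := continuous_norm.continuousAt.eventually (lt_mem_nhds hx)
    filter_upwards [this] with y hy using h0 y hy.le
  simp [gradient, h1.fderiv_eq]

lemma grad_smul {n : ℕ} (χ : EuclideanSpace ℝ (Fin n) → ℝ) (c : ℝ)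
    (x : EuclideanSpace ℝ (Fin n)) :
    gradient (fun y => χ (c • y)) x = c • gradient χ (c • x) := by
  have := fderiv_comp_smul (𝕜 := ℝ) (f := χ) (x := x) c
  simp [gradient, this]

lemma ball_bound {n : ℕ} (p : ℝ) (hp1 : 1 ≤ p)
    (g : EuclideanSpace ℝ (Fin n) → EuclideanSpace ℝ (Fin n))
    (hg : MemLp g (ENNReal.ofReal p) volume) :
    ∃ C : ℝ, ∀ R : ℝ, 0 ≤ R →
      IntegrableOn g (Metric.closedBall 0 R) ∧
      ∫ x in Metric.closedBall 0 R, ‖g x‖ ≤ C * R ^ ((n : ℝ) * (1 - 1 / p)) := by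
  have hp0 : 0 < p := by linarith
  refine ⟨(eLpNorm g (ENNReal.ofReal p) volume).toReal *
    (volume (Metric.closedBall (0 : EuclideanSpace ℝ (Fin n)) 1)).toReal ^ (1 - 1 / p), ?_⟩
  intro R hR
  set B := Metric.closedBall (0 : EuclideanSpace ℝ (Fin n)) R with hB
  have hfin : volume B < ⊤ := measure_closedBall_lt_top
  have : IsFiniteMeasure (volume.restrict B) := ⟨by simpa using hfin⟩
  have hgB : IntegrableOn g B := (hg.restrict B).integrable (by simpa using hp1)
  refine ⟨hgB, ?_⟩
  have e1 : ∫ x in B, ‖g x‖ = (eLpNorm g 1 (volume.restrict B)).toReal := by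
    rw [integral_norm_eq_lintegral_enorm hgB.aestronglyMeasurable, eLpNorm_one_eq_lintegral_enorm]
  have e2 := eLpNorm_le_eLpNorm_mul_rpow_measure_univ (μ := volume.restrict B) (f := g)
    (p := 1) (q := ENNReal.ofReal p) (by simpa using hp1) hgB.aestronglyMeasurable
  have e3 : eLpNorm g (ENNReal.ofReal p) (volume.restrict B) ≤
      eLpNorm g (ENNReal.ofReal p) volume := eLpNorm_mono_measure _ Measure.restrict_le_self
  have hexp : 0 ≤ 1 - 1 / p := by
    rw [sub_nonneg, div_le_one hp0]; exact hp1
  have e4 : eLpNorm g 1 (volume.restrict B) ≤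
      eLpNorm g (ENNReal.ofReal p) volume * (volume B) ^ (1 - 1 / p) := by
    refine e2.trans ?_
    simp only [Measure.restrict_apply_univ, ENNReal.toReal_one,
      ENNReal.toReal_ofReal hp0.le, div_one]
    gcongr
  have e5 : (volume B).toReal = R ^ n *
      (volume (Metric.closedBall (0 : EuclideanSpace ℝ (Fin n)) 1)).toReal := by
    rw [hB, Measure.addHaar_closedBall' volume _ hR]
    simp [ENNReal.toReal_mul, hR]
  rw [e1]
  refine (ENNReal.toReal_mono (ENNReal.mul_ne_top hg.2.ne
    (ENNReal.rpow_ne_top_of_nonneg hexp hfin.ne)) e4).trans ?_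
  rw [ENNReal.toReal_mul, ← ENNReal.toReal_rpow, e5,
    Real.mul_rpow (by positivity) ENNReal.toReal_nonneg, ← Real.rpow_natCast,
    ← Real.rpow_mul hR]
  apply le_of_eq; ring

lemma cutoff_tendsto
    {n : ℕ} (p : ℝ) (hp1 : 1 ≤ p) (hp2 : ((n : ℝ) - 1) * p < n)
    (g : EuclideanSpace ℝ (Fin n) → EuclideanSpace ℝ (Fin n))
    (hg : MemLp g (ENNReal.ofReal p) volume)
    (χ : EuclideanSpace ℝ (Fin n) → ℝ) (hχ : ContDiff ℝ (⊤ : ℕ∞) χ) (hc : HasCompactSupport χ)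
    (h0 : ∀ x, 2 ≤ ‖x‖ → χ x = 0) :
      Filter.Tendsto
        (fun k : ℕ => -(1 / (k : ℝ)) * ∫ x, ⟪g x, gradient χ ((1 / (k : ℝ)) • x)⟫)
        Filter.atTop (nhds 0) := by
  have hp0 : 0 < p := by linarith
  obtain ⟨M, hM0, hM⟩ := grad_bound χ hχ hc
  obtain ⟨C, hC⟩ := ball_bound p hp1 g hg
  set s : ℝ := (n : ℝ) * (1 - 1 / p) with hs
  have hs1 : 0 < 1 - s := by
    have : (n : ℝ) - 1 < n / p := by rwa [lt_div_iff₀ hp0]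
    have h2 : s = n - n / p := by rw [hs]; ring
    linarith
  have lim : Filter.Tendsto (fun k : ℕ => (M * C * 2 ^ s) * (k : ℝ) ^ (-(1 - s)))
      Filter.atTop (nhds 0) := by
    have := ((tendsto_rpow_neg_atTop hs1).comp tendsto_natCast_atTop_atTop).const_mul
      (M * C * 2 ^ s)
    simpa using this
  refine squeeze_zero_norm' ?_ lim
  filter_upwards [Filter.eventually_gt_atTop 0] with k hk
  have hk0 : (0 : ℝ) < k := by exact_mod_cast hk
  obtain ⟨hi, hb⟩ := hC (2 * k) (by positivity)
  set B := Metric.closedBall (0 : EuclideanSpace ℝ (Fin n)) (2 * k) with hB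
  have hz : ∀ x, x ∉ B → ⟪g x, gradient χ ((1 / (k : ℝ)) • x)⟫ = 0 := by
    intro x hx
    rw [grad_zero χ h0, inner_zero_right]
    rw [hB, mem_closedBall_zero_iff, not_le] at hx
    rw [norm_smul, Real.norm_of_nonneg (by positivity), one_div, ← div_eq_inv_mul,
      lt_div_iff₀ hk0]
    exact hx
  have key : ‖∫ x, ⟪g x, gradient χ ((1 / (k : ℝ)) • x)⟫‖ ≤ M * (C * (2 * k) ^ s) := by
    rw [← setIntegral_eq_integral_of_forall_compl_eq_zero hz]
    refine (norm_integral_le_of_norm_le (hi.norm.const_mul M) ?_).trans ?_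
    · refine Filter.Eventually.of_forall fun x => ?_
      refine (norm_inner_le_norm _ _).trans ?_
      rw [mul_comm]
      exact mul_le_mul_of_nonneg_right (hM _) (norm_nonneg _)
    · rw [integral_const_mul]
      exact mul_le_mul_of_nonneg_left hb hM0
  rw [norm_mul, norm_neg, Real.norm_of_nonneg (by positivity : (0 : ℝ) ≤ 1 / k)]
  refine (mul_le_mul_of_nonneg_left key (by positivity)).trans (le_of_eq ?_)
  rw [Real.mul_rpow (by norm_num) hk0.le, neg_sub, Real.rpow_sub hk0, Real.rpow_one]
  ring



/-- **The divergence of a localized vector field has zero integral**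
(Lemma `intlem` of the paper). If `g ∈ Lᵖ(ℝⁿ)ⁿ` with `1 ≤ p < ∞` and `(n-1)p < n`,
and if `h ∈ L¹(ℝⁿ)` is the distributional divergence of `g`, then `∫ h dx = 0`;
moreover, for any smooth cut-off `χ` with values in `[0,1]`, equal to `1` on the unit
ball and to `0` outside the ball of radius `2`, one has
`-(1/k)∫ g(x)·∇χ(x/k) dx → 0` as `k → ∞`. -/
theorem integral_of_divergence_eq_zero
    {n : ℕ} (hn : 1 ≤ n) (p : ℝ) (hp1 : 1 ≤ p) (hp2 : ((n : ℝ) - 1) * p < n)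
    (g : EuclideanSpace ℝ (Fin n) → EuclideanSpace ℝ (Fin n))
    (hg : MemLp g (ENNReal.ofReal p) volume)
    (h : EuclideanSpace ℝ (Fin n) → ℝ) (hh : Integrable h)
    (hdiv : ∀ v : EuclideanSpace ℝ (Fin n) → ℝ, ContDiff ℝ (⊤ : ℕ∞) v →
      HasCompactSupport v → ∫ x, h x * v x = -∫ x, ⟪g x, gradient v x⟫) :
    (∫ x, h x) = 0 ∧
    ∀ χ : EuclideanSpace ℝ (Fin n) → ℝ, ContDiff ℝ (⊤ : ℕ∞) χ → HasCompactSupport χ →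
      (∀ x, χ x ∈ Set.Icc (0 : ℝ) 1) →
      (∀ x, ‖x‖ ≤ 1 → χ x = 1) → (∀ x, 2 ≤ ‖x‖ → χ x = 0) →
      Filter.Tendsto
        (fun k : ℕ => -(1 / (k : ℝ)) * ∫ x, ⟪g x, gradient χ ((1 / (k : ℝ)) • x)⟫)
        Filter.atTop (nhds 0) := by
  refine ⟨?_, fun χ hχ hc _ _ h0 => cutoff_tendsto p hp1 hp2 g hg χ hχ hc h0⟩
  let χ : ContDiffBump (0 : EuclideanSpace ℝ (Fin n)) := ⟨1, 2, by norm_num, by norm_num⟩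
  have hχ : ContDiff ℝ (⊤ : ℕ∞) χ := χ.contDiff
  have h0 : ∀ x, 2 ≤ ‖x‖ → χ x = 0 := fun x hx => χ.zero_of_le_dist (by simpa [χ] using hx)
  have h1 : ∀ x, ‖x‖ ≤ 1 → χ x = 1 :=
    fun x hx => χ.one_of_mem_closedBall (by simpa [χ] using hx)
  have t1 := cutoff_tendsto p hp1 hp2 g hg χ hχ χ.hasCompactSupport h0
  have t2 : Filter.Tendsto (fun k : ℕ => ∫ x, h x * χ ((1 / (k : ℝ)) • x))
      Filter.atTop (nhds (∫ x, h x)) := by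
    refine tendsto_integral_of_dominated_convergence (fun x => ‖h x‖) ?_ hh.norm ?_ ?_
    · intro k
      refine hh.aestronglyMeasurable.mul (Continuous.aestronglyMeasurable ?_)
      exact hχ.continuous.comp (continuous_const_smul _)
    · intro k
      refine Filter.Eventually.of_forall fun x => ?_
      rw [norm_mul, Real.norm_of_nonneg (χ.nonneg' _)]
      exact mul_le_of_le_one_right (norm_nonneg _) χ.le_one
    · refine Filter.Eventually.of_forall fun x => ?_
      refine tendsto_const_nhds.congr' ?_
      filter_upwards [Filter.eventually_gt_atTop 0, Filter.eventually_ge_atTop ⌈‖x‖⌉₊]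
        with k hk hkx
      have hk0 : (0 : ℝ) < k := by exact_mod_cast hk
      rw [h1, mul_one]
      rw [norm_smul, Real.norm_of_nonneg (by positivity), one_div, ← div_eq_inv_mul,
        div_le_one hk0]
      exact Nat.ceil_le.mp hkx
  refine tendsto_nhds_unique (t2.congr' ?_) t1
  filter_upwards [Filter.eventually_gt_atTop 0] with k hk
  have hk0 : (1 / (k : ℝ)) ≠ 0 := by
    have : (k : ℝ) ≠ 0 := by exact_mod_cast hk.ne'
    positivity
  rw [hdiv (fun x => χ ((1 / (k : ℝ)) • x)) (hχ.comp (contDiff_const_smul _))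
    (χ.hasCompactSupport.comp_smul hk0)]
  simp_rw [grad_smul, inner_smul_right]
  rw [integral_const_mul, neg_mul]
end
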